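/- Let G = A × B be the direct product of groups A and B, and let φ be an injective endomorphism of G with Aφ ⊆ A and Bφ ⊆ B. Let B(φ) = ⟨B, s ; s⁻¹bs = bφ (b ∈ B)⟩ be the descending HNN-extension of B with respect to the restriction of φ to B, and let ρ : G(φ) → B(φ) be the homomorphism sending the stable letter t of G(φ) to the stable letter s of B(φ) and acting on G as the projection π : G → B. Then the kernel of ρ equals U = ⋃_{k≥0} tᵏAt⁻ᵏ, where A is identified with its canonical image in G(φ). -/

import Mathlib

/-- A group has the Howson property if the intersection of any two finitely
generated subgroups is finitely generated. -/
def HowsonGroup (G : Type*) [Group G] : Prop :=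
  ∀ H K : Subgroup G, H.FG → K.FG → (H ⊓ K).FG

/-- The descending HNN-extension `G(φ) = ⟨G, t ; t⁻¹ g t = gφ (g ∈ G)⟩` of a group `G`
with respect to an injective endomorphism `φ`, realized as the Mathlib `HNNExtension`
with base `G`, associated subgroups `φ.range` and `G` (i.e. `⊤`), so that the relation
`t⁻¹ * of g * t = of (φ g)` holds for all `g : G`. -/
abbrev DescHNN {G : Type*} [Group G] (φ : G →* G) (hφ : Function.Injective φ) : Type _ :=
  HNNExtension G (MonoidHom.range φ) ⊤
    ((MonoidHom.ofInjective hφ).symm.trans Subgroup.topEquiv.symm)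

namespace DescHNN

variable {G : Type*} [Group G] {φ : G →* G} {hφ : Function.Injective φ}

theorem of_mul_t (g : G) :
    (HNNExtension.of g : DescHNN φ hφ) * HNNExtension.t =
      HNNExtension.t * HNNExtension.of (φ g) :=
  HNNExtension.of_mul_t (⟨g, Subgroup.mem_top g⟩ : (⊤ : Subgroup G))

theorem of_mul_t_pow (g : G) (n : ℕ) :
    (HNNExtension.of g : DescHNN φ hφ) * HNNExtension.t ^ n =
      HNNExtension.t ^ n * HNNExtension.of (φ^[n] g) := by
  induction n generalizing g with
  | zero => simp
  | succ n ih =>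
    rw [pow_succ', ← mul_assoc, of_mul_t, mul_assoc, ih, Function.iterate_succ_apply, mul_assoc]

theorem t_pow_inv_mul_of (g : G) (n : ℕ) :
    (HNNExtension.t ^ n)⁻¹ * (HNNExtension.of g : DescHNN φ hφ) =
      HNNExtension.of (φ^[n] g) * (HNNExtension.t ^ n)⁻¹ := by
  rw [inv_mul_eq_iff_eq_mul, ← mul_assoc, ← of_mul_t_pow, mul_inv_cancel_right]

/-- Every element of a descending HNN-extension has the form `tⁱ g t⁻ʲ`. -/
theorem exists_eq_t_pow_mul_of_mul_t_pow_inv (x : DescHNN φ hφ) :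
    ∃ (i : ℕ) (g : G) (j : ℕ),
      x = HNNExtension.t ^ i * HNNExtension.of g * (HNNExtension.t ^ j)⁻¹ := by
  induction x using HNNExtension.induction_on with
  | of g => exact ⟨0, g, 0, by simp⟩
  | t => exact ⟨1, 1, 0, by simp⟩
  | inv x hx =>
    obtain ⟨i, g, j, rfl⟩ := hx
    exact ⟨j, g⁻¹, i, by simp [mul_assoc]⟩
  | mul x y hx hy =>
    obtain ⟨i, g, j, rfl⟩ := hx
    obtain ⟨k, h, l, rfl⟩ := hy
    rcases le_total j k with hjk | hkj
    · obtain ⟨m, rfl⟩ := Nat.exists_eq_add_of_le hjk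
      refine ⟨i + m, φ^[m] g * h, l, ?_⟩
      have key := of_mul_t_pow (hφ := hφ) g m
      simp only [pow_add, map_mul, mul_assoc, inv_mul_cancel_left]
      simp only [← mul_assoc] at key ⊢
      rw [mul_assoc _ (HNNExtension.of g), key, ← mul_assoc]
    · obtain ⟨m, rfl⟩ := Nat.exists_eq_add_of_le hkj
      refine ⟨i, g * φ^[m] h, l + m, ?_⟩
      have key := t_pow_inv_mul_of (hφ := hφ) h m
      simp only [pow_add, map_mul, mul_assoc, mul_inv_rev, inv_mul_cancel_left]
      simp only [← mul_assoc] at key ⊢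
      rw [mul_assoc _ (HNNExtension.t ^ m)⁻¹, key, ← mul_assoc]

/-- The exponent sum of the stable letter. -/
noncomputable def tExponent (φ : G →* G) (hφ : Function.Injective φ) : DescHNN φ hφ →* Multiplicative ℤ :=
  HNNExtension.lift 1 (Multiplicative.ofAdd 1) (by simp)

theorem eq_one_of_t_pow_mul_of_mul_t_pow_inv_eq_one {i j : ℕ} {g : G}
    (h : (HNNExtension.t ^ i * HNNExtension.of g * (HNNExtension.t ^ j)⁻¹ : DescHNN φ hφ) = 1) :
    i = j ∧ g = 1 := by
  have hij : i = j := by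
    have := congrArg (tExponent φ hφ) h
    simp only [tExponent, map_mul, map_pow, map_inv, HNNExtension.lift_t, HNNExtension.lift_of,
      MonoidHom.one_apply, mul_one, map_one, mul_inv_eq_one, ← ofAdd_nsmul] at this
    simpa using this
  subst hij
  exact ⟨rfl, (map_eq_one_iff _ (HNNExtension.of_injective _)).1 (conj_eq_one_iff.1 h)⟩

end DescHNN

/-- Let `G = A × B`, and let `φ` be an injective endomorphism of `G` with `Aφ ⊆ A` and
`Bφ ⊆ B`. Let `ψ` be the restriction of `φ` to `B`, `B(ψ)` the corresponding descending
HNN-extension, and `ρ : G(φ) →* B(ψ)` the homomorphism sending the stable letter of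
`G(φ)` to the stable letter of `B(ψ)` and acting on `G` as the projection `π : G → B`.
Then `ker ρ = U = ⋃_{k ≥ 0} tᵏAt⁻ᵏ`, where `A` is identified with its canonical image
in `G(φ)`. -/
theorem ker_rho_eq_U {A B : Type*} [Group A] [Group B]
    (φ : A × B →* A × B) (hφ : Function.Injective φ)
    (hAφ : ((MonoidHom.inl A B).range).map φ ≤ (MonoidHom.inl A B).range)
    (hBφ : ((MonoidHom.inr A B).range).map φ ≤ (MonoidHom.inr A B).range)
    (ψ : B →* B) (hψ : ∀ b : B, φ (1, b) = (1, ψ b)) (hψinj : Function.Injective ψ)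
    (ρ : DescHNN φ hφ →* DescHNN ψ hψinj)
    (hρt : ρ HNNExtension.t = HNNExtension.t)
    (hρof : ∀ g : A × B, ρ (HNNExtension.of g) = HNNExtension.of g.2) :
    MonoidHom.ker ρ = ⨆ k : ℕ,
      (((MonoidHom.inl A B).range).map (HNNExtension.of : A × B →* DescHNN φ hφ)).map
        (MulAut.conj (HNNExtension.t ^ k)).toMonoidHom := by
  apply le_antisymm
  · intro x hx
    obtain ⟨i, ⟨a, b⟩, j, rfl⟩ := DescHNN.exists_eq_t_pow_mul_of_mul_t_pow_inv x
    rw [MonoidHom.mem_ker] at hx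
    simp only [map_mul, map_pow, map_inv, hρt, hρof] at hx
    obtain ⟨rfl, rfl⟩ := DescHNN.eq_one_of_t_pow_mul_of_mul_t_pow_inv_eq_one hx
    exact Subgroup.mem_iSup_of_mem i ⟨_, ⟨_, ⟨a, rfl⟩, rfl⟩, rfl⟩
  · refine iSup_le fun k => ?_
    rintro _ ⟨_, ⟨_, ⟨a, rfl⟩, rfl⟩, rfl⟩
    simp [MonoidHom.mem_ker, hρof, -map_pow, MulAut.conj_apply]
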